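/- Let c be a fully invariant congruence on F with c ≠ ⊥ (i.e. c corresponds to a proper monoid variety) such that c is a modular element of the lattice 𝓛 of fully invariant congruences on F. Then c x² x³ and c (x²y) (yx²). (In variety language: every proper monoid variety that is a modular element of the lattice of monoid varieties satisfies the identities x² ≈ x³ and x²y ≈ yx².) -/

import Mathlib

/-- The free monoid on countably many generators. -/
abbrev F : Type := FreeMonoid ℕ

/-- The fixed pairwise distinct generators. -/
def x : F := FreeMonoid.of 0
def y : F := FreeMonoid.of 1
def z : F := FreeMonoid.of 2
def t : F := FreeMonoid.of 3

/-- A congruence on `F` is fully invariant if it is stable under every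
monoid endomorphism of `F`. -/
def IsFullyInvariant (c : Con F) : Prop :=
  ∀ ξ : F →* F, ∀ u v : F, c u v → c (ξ u) (ξ v)

/-- The type of fully invariant congruences on `F`. -/
abbrev FICon : Type := {c : Con F // IsFullyInvariant c}

instance : InfSet FICon :=
  ⟨fun S => ⟨sInf (Subtype.val '' S), fun ξ u v h c hc => by
    obtain ⟨d, hd, rfl⟩ := hc
    exact d.2 ξ u v (h d.1 ⟨d, hd, rfl⟩)⟩⟩

/-- The complete lattice of fully invariant congruences on `F`:
meets are intersections, joins are the smallest fully invariant congruences
containing the union, `⊥` is the equality relation and `⊤` is the all relation. -/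
noncomputable instance : CompleteLattice FICon :=
  completeLatticeOfInf FICon (fun S =>
    ⟨fun c hc => fun u v h => h c.1 ⟨c, hc, rfl⟩,
     fun c hc => fun u v h d hd => by
        obtain ⟨e, he, rfl⟩ := hd
        exact hc he h⟩)

/-- `fic S` is the smallest fully invariant congruence on `F` containing the
set `S` of pairs of words. -/
noncomputable def fic (S : Set (F × F)) : FICon :=
  sInf {c : FICon | ∀ p ∈ S, c.1 p.1 p.2}

/-- The largest fully invariant congruence saturating every set in `A`. -/
def saturating (A : Set (Set F)) : FICon :=
  ⟨{ r := fun u v => ∀ X ∈ A, ∀ ξ : F →* F, ∀ a b : F, a * ξ u * b ∈ X ↔ a * ξ v * b ∈ X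
     iseqv :=
      { refl := fun _ _ _ _ _ _ => Iff.rfl
        symm := fun h X hX ξ a b => (h X hX ξ a b).symm
        trans := fun h h' X hX ξ a b => (h X hX ξ a b).trans (h' X hX ξ a b) }
     mul' := fun {w x y z} h h' X hX ξ a b => by
      have h₁ := h X hX ξ a (ξ y * b)
      have h₂ := h' X hX ξ (a * ξ x) b
      simp only [map_mul, mul_assoc] at h₁ h₂ ⊢
      exact h₁.trans h₂ },
   fun η _ _ h X hX ξ a b => h X hX (ξ.comp η) a b⟩

theorem saturating_mem_iff {A : Set (Set F)} {X : Set F} (hX : X ∈ A) {u v : F}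
    (h : (saturating A).1 u v) : u ∈ X ↔ v ∈ X := by
  simpa using h X hX (MonoidHom.id F) 1 1

/-- A modular fully invariant congruence relates an element of `S` to an element of `T` as soon as
`p ∈ S` and `q ∈ T` are connected through an identity `p' ≈ q'` respecting both sets, while
`p ≈ q` respects their union. -/
theorem exists_rel_of_modular {c : FICon}
    (hmod : ∀ b d : FICon, b ≤ d → (c ⊓ d) ⊔ b = (c ⊔ b) ⊓ d)
    {S T : Set F} {p q p' q' : F} (hp : p ∈ S) (hq : q ∈ T) (hST : Disjoint S T)
    (hU : ∀ (ξ : F →* F) (a b : F), a * ξ p * b ∈ S ∪ T ↔ a * ξ q * b ∈ S ∪ T)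
    (hS : ∀ (ξ : F →* F) (a b : F), a * ξ p' * b ∈ S ↔ a * ξ q' * b ∈ S)
    (hT : ∀ (ξ : F →* F) (a b : F), a * ξ p' * b ∈ T ↔ a * ξ q' * b ∈ T)
    (hpp : c.1 p p') (hqq : c.1 q' q) : ∃ w ∈ S, ∃ w' ∈ T, c.1 w w' := by
  by_contra hcon
  push Not at hcon
  set d := saturating {S ∪ T}
  set b := saturating {S, T}
  have hbd : b ≤ d := by
    intro u v h X hX ξ a e
    obtain rfl : X = S ∪ T := hX
    exact or_congr (h S (by simp) ξ a e) (h T (by simp) ξ a e)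
  have hb : b.1 p' q' := by
    rintro X (rfl | rfl) ξ a e
    exacts [hS ξ a e, hT ξ a e]
  have hd : d.1 p q := by
    rintro X rfl ξ a e
    exact hU ξ a e
  have hle : (c ⊓ d) ⊔ b ≤ saturating {S} := by
    have key : ∀ u v, c.1 u v → d.1 u v → u ∈ S → v ∈ S := by
      intro u v hc hd' hu
      rcases (saturating_mem_iff (Set.mem_singleton _) hd').1 (Or.inl hu) with h | h
      · exact h
      · exact absurd hc (hcon u hu v h)
    refine sup_le ?_ ?_
    · rintro u v h X rfl ξ a e
      have hc : c.1 (a * ξ u * e) (a * ξ v * e) :=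
        c.1.mul (c.1.mul (c.1.refl a) (c.2 ξ _ _ ((inf_le_left : c ⊓ d ≤ c) h))) (c.1.refl e)
      have hd' : d.1 (a * ξ u * e) (a * ξ v * e) :=
        d.1.mul (d.1.mul (d.1.refl a) (d.2 ξ _ _ ((inf_le_right : c ⊓ d ≤ d) h))) (d.1.refl e)
      exact ⟨key _ _ hc hd', key _ _ (c.1.symm hc) (d.1.symm hd')⟩
    · rintro u v h X rfl ξ a e
      exact h X (by simp) ξ a e
  have hsup : (c ⊔ b).1 p q :=
    (c ⊔ b).1.trans ((le_sup_left : c ≤ c ⊔ b) hpp)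
      ((c ⊔ b).1.trans ((le_sup_right : b ≤ c ⊔ b) hb) ((le_sup_left : c ≤ c ⊔ b) hqq))
  have hinf : (c ⊔ b) ⊓ d ≤ saturating {S} := hmod b d hbd ▸ hle
  have hpq : ((c ⊔ b) ⊓ d).1 p q := by
    have : fic {(p, q)} ≤ (c ⊔ b) ⊓ d :=
      le_inf (sInf_le (by rintro _ rfl; exact hsup)) (sInf_le (by rintro _ rfl; exact hd))
    refine this ?_
    rintro _ ⟨e, he, rfl⟩
    exact he (p, q) rfl
  exact Set.disjoint_left.1 hST
    ((saturating_mem_iff (Set.mem_singleton _) (hinf hpq)).1 hp) hq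

/-- The special case of `exists_rel_of_modular` for singletons. -/
theorem rel_of_modular {c : FICon}
    (hmod : ∀ b d : FICon, b ≤ d → (c ⊓ d) ⊔ b = (c ⊔ b) ⊓ d)
    {p q p' q' : F} (hpq : p ≠ q)
    (hU : ∀ (ξ : F →* F) (a b : F),
      (a * ξ p * b = p ∨ a * ξ p * b = q) ↔ (a * ξ q * b = p ∨ a * ξ q * b = q))
    (hS : ∀ (ξ : F →* F) (a b : F), a * ξ p' * b = p ↔ a * ξ q' * b = p)
    (hT : ∀ (ξ : F →* F) (a b : F), a * ξ p' * b = q ↔ a * ξ q' * b = q)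
    (hpp : c.1 p p') (hqq : c.1 q' q) : c.1 p q := by
  obtain ⟨w, rfl, w', rfl, h⟩ := exists_rel_of_modular hmod (S := {p}) (T := {q}) rfl rfl
    (by simpa using hpq) hU hS hT hpp hqq
  exact h

theorem length_pow (w : F) (n : ℕ) : (w ^ n).length = n * w.length := by
  induction n with
  | zero => simp
  | succ n ih => rw [pow_succ, FreeMonoid.length_mul, ih, Nat.succ_mul]

theorem length_pos {w : F} (h : w ≠ 1) : 1 ≤ w.length :=
  Nat.one_le_iff_ne_zero.2 fun h' => h (FreeMonoid.length_eq_zero.1 h')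

theorem of_mul_inj {m n : ℕ} {u v : F} :
    FreeMonoid.of m * u = FreeMonoid.of n * v ↔ m = n ∧ u = v :=
  List.cons_eq_cons

theorem of_mul_ne_one (m : ℕ) (u : F) : FreeMonoid.of m * u ≠ 1 := List.cons_ne_nil m u

theorem eq_one_or (w : F) : w = 1 ∨ ∃ n w', w = FreeMonoid.of n * w' := by
  cases w using FreeMonoid.casesOn with
  | one => exact Or.inl rfl
  | of_mul n w => exact Or.inr ⟨n, w, rfl⟩

/-- The endomorphism sending the generators `0`, `1`, `2` to `u`, `v`, `w`, and all others
to `1`. -/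
def substHom (u v w : F) : F →* F :=
  FreeMonoid.lift fun n => if n = 0 then u else if n = 1 then v else if n = 2 then w else 1

theorem substHom_x (u v w : F) : substHom u v w x = u := rfl
theorem substHom_y (u v w : F) : substHom u v w y = v := rfl

/-- If `c` is modular and satisfies `x ^ k ≈ x ^ l`, then large powers are central. -/
theorem pow_mul_comm_of_modular {c : FICon}
    (hmod : ∀ b d : FICon, b ≤ d → (c ⊓ d) ⊔ b = (c ⊔ b) ⊓ d)
    {k l K : ℕ} (hkl : k < l) (hkK : k ≤ K) (hK : 2 ≤ K) (h : c.1 (x ^ k) (x ^ l)) :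
    c.1 (x ^ K * y) (y * x ^ K) := by
  have hpow : c.1 (x ^ K) (x ^ (K + (l - k))) := by
    have := c.1.mul h (c.1.refl (x ^ (K - k)))
    rw [← pow_add, ← pow_add] at this
    convert this using 2 <;> omega
  obtain ⟨K, rfl⟩ := Nat.exists_eq_add_of_le' hK
  have hp : (x ^ (K + 2) * y).length = K + 3 := by
    rw [FreeMonoid.length_mul, length_pow]; simp [x, y]
  have hq : (y * x ^ (K + 2)).length = K + 3 := by
    rw [FreeMonoid.length_mul, length_pow]; simp [x, y]; omega
  have long : ∀ (ξ : F →* F) (a b : F), ξ x ≠ 1 → ξ y ≠ 1 →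
      K + 3 < (a * ξ (x ^ (K + 2 + (l - k)) * y) * b).length ∧
      K + 3 < (a * ξ (y * x ^ (K + 2 + (l - k))) * b).length := by
    intro ξ a b hX hY
    have := length_pos hX
    have := length_pos hY
    simp only [map_mul, map_pow, FreeMonoid.length_mul, length_pow]
    constructor <;> nlinarith [Nat.sub_pos_of_lt hkl]
  have triv : ∀ (n : ℕ) (ξ : F →* F), ξ x = 1 ∨ ξ y = 1 → ξ (x ^ n * y) = ξ (y * x ^ n) := by
    rintro n ξ (h | h) <;> simp [h]
  refine rel_of_modular hmod (p' := x ^ (K + 2 + (l - k)) * y) (q' := y * x ^ (K + 2 + (l - k)))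
    ?_ ?_ ?_ ?_ (c.1.mul hpow (c.1.refl y)) (c.1.mul (c.1.refl y) (c.1.symm hpow))
  · rw [pow_succ', mul_assoc, x, y, Ne, of_mul_inj]
    simp
  · intro ξ a b
    by_cases h1 : ξ x = 1 ∨ ξ y = 1
    · rw [triv _ _ h1]
    push Not at h1
    have hX := length_pos h1.1
    have hY := length_pos h1.2
    by_cases hlen : a.length + (K + 2) * (ξ x).length + (ξ y).length + b.length = K + 3
    · obtain ⟨m, hm⟩ := FreeMonoid.length_eq_one.1 (show (ξ x).length = 1 by nlinarith)
      obtain ⟨n, hn⟩ := FreeMonoid.length_eq_one.1 (show (ξ y).length = 1 by nlinarith)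
      obtain rfl := FreeMonoid.length_eq_zero.1 (show a.length = 0 by nlinarith)
      obtain rfl := FreeMonoid.length_eq_zero.1 (show b.length = 0 by nlinarith)
      simp only [map_mul, map_pow, hm, hn, one_mul, mul_one]
      have e1 : ∀ w : F, w ^ (K + 2) = w * (w * w ^ K) := fun w => by
        rw [pow_succ', pow_succ']
      have e2 : ∀ w v : F, w ^ (K + 2) * v = w * (w * (w ^ K * v)) := fun w v => by
        rw [e1, mul_assoc, mul_assoc]
      constructor
      · rintro (h | h)
        · have h' := h
          rw [e2, e2, x, of_mul_inj] at h'
          obtain ⟨rfl, -⟩ := h'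
          rw [← mul_left_cancel h]
          exact Or.inr rfl
        · rw [e2, e1, x, y, of_mul_inj, of_mul_inj] at h
          omega
      · rintro (h | h)
        · have h' := h
          rw [e1, e2, x, of_mul_inj, of_mul_inj] at h'
          obtain ⟨rfl, rfl, -⟩ := h'
          rw [← h, ← pow_succ, ← pow_succ']
          exact Or.inl rfl
        · rw [y, x, of_mul_inj, e1, e1, of_mul_inj] at h
          obtain ⟨rfl, rfl, -⟩ := h
          exact Or.inl rfl
    · have e1 : (a * ξ (x ^ (K + 2) * y) * b).length ≠ K + 3 := by
        simp only [map_mul, map_pow, FreeMonoid.length_mul, length_pow]; omega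
      have e2 : (a * ξ (y * x ^ (K + 2)) * b).length ≠ K + 3 := by
        simp only [map_mul, map_pow, FreeMonoid.length_mul, length_pow]; omega
      constructor
      · rintro (h | h)
        · exact absurd (congrArg FreeMonoid.length h |>.trans hp) e1
        · exact absurd (congrArg FreeMonoid.length h |>.trans hq) e1
      · rintro (h | h)
        · exact absurd (congrArg FreeMonoid.length h |>.trans hp) e2
        · exact absurd (congrArg FreeMonoid.length h |>.trans hq) e2
  all_goals
    intro ξ a b
    by_cases h1 : ξ x = 1 ∨ ξ y = 1
    · rw [triv _ _ h1]
    push Not at h1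
    obtain ⟨l1, l2⟩ := long ξ a b h1.1 h1.2
    constructor
    · intro h
      rw [h] at l1
      omega
    · intro h
      rw [h] at l2
      omega

/-- Neither `x ^ 2 * y ^ 2 * x ^ 2 * y` nor its dual under exchanging letters contains a cube. -/
theorem eq_one_of_cube {i j : ℕ} (hij : i ≠ j) {a w b : F}
    (h : a * w ^ 3 * b = FreeMonoid.ofList [i, i, j, j, i, i, j]) : w = 1 := by
  have hl : a.toList ++ (w.toList ++ (w.toList ++ (w.toList ++ b.toList))) =
      [i, i, j, j, i, i, j] := by
    rw [← FreeMonoid.toList_ofList [i, i, j, j, i, i, j], ← h]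
    simp [pow_succ]
  have hlen := congrArg List.length hl
  have key : (List.drop a.toList.length [i, i, j, j, i, i, j]).take (2 * w.toList.length) =
      (List.drop (a.toList.length + w.toList.length) [i, i, j, j, i, i, j]).take
        (2 * w.toList.length) := by
    rw [← hl]
    simp [List.drop_append, List.take_append, two_mul]
  simp only [List.length_append, List.length_cons, List.length_nil] at hlen
  generalize a.toList.length = n at *
  generalize hm : w.toList.length = m at *
  suffices m = 0 by
    subst this
    exact FreeMonoid.length_eq_zero.1 hm
  have : m ≤ 2 := by omega
  interval_cases m
  · rfl
  · have : n ≤ 4 := by omega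
    interval_cases n <;> simp_all
  · have : n ≤ 1 := by omega
    interval_cases n <;> simp_all

/-- If `c` is modular and makes squares central, then it satisfies `x ^ 4 ≈ x ^ 3`. -/
theorem pow_four_of_modular {c : FICon}
    (hmod : ∀ b d : FICon, b ≤ d → (c ⊓ d) ⊔ b = (c ⊔ b) ⊓ d)
    (h : c.1 (x ^ 2 * y) (y * x ^ 2)) : c.1 (x ^ 4) (x ^ 3) := by
  have comm : ∀ u v : F, c.1 (u ^ 2 * v ^ 2 * u ^ 2 * v) (u ^ 4 * v ^ 3) := by
    intro u v
    have h' := c.2 (substHom u (v ^ 2) 1) _ _ h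
    simp only [map_mul, map_pow, substHom_x, substHom_y] at h'
    have := c.1.mul (c.1.refl (u ^ 2)) (c.1.mul (c.1.symm h') (c.1.refl v))
    convert this using 1 <;> simp only [pow_succ, pow_zero, one_mul, mul_assoc]
  have hp : x ^ 2 * y ^ 2 * x ^ 2 * y = FreeMonoid.ofList [0, 0, 1, 1, 0, 0, 1] := rfl
  have hq : y ^ 2 * x ^ 2 * y ^ 2 * x = FreeMonoid.ofList [1, 1, 0, 0, 1, 1, 0] := rfl
  have nocube : ∀ {a w b v : F}, a * w ^ 3 * b = v → w ≠ 1 →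
      v ≠ x ^ 2 * y ^ 2 * x ^ 2 * y ∧ v ≠ y ^ 2 * x ^ 2 * y ^ 2 * x := by
    rintro a w b _ rfl hw
    exact ⟨fun h => hw (eq_one_of_cube zero_ne_one (h.trans hp)),
      fun h => hw (eq_one_of_cube one_ne_zero (h.trans hq))⟩
  have nocube₂ : ∀ u v a b : F, (u ≠ 1 ∨ v ≠ 1) →
      a * (u ^ 4 * v ^ 3) * b ≠ x ^ 2 * y ^ 2 * x ^ 2 * y ∧
      a * (u ^ 4 * v ^ 3) * b ≠ y ^ 2 * x ^ 2 * y ^ 2 * x := by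
    rintro u v a b (hu | hv)
    · exact nocube (a := a) (b := u * v ^ 3 * b) (by simp only [pow_succ, mul_assoc]) hu
    · exact nocube (a := a * u ^ 4) (b := b) (by simp only [mul_assoc]) hv
  have hrel := rel_of_modular hmod (p := x ^ 2 * y ^ 2 * x ^ 2 * y)
    (q := y ^ 2 * x ^ 2 * y ^ 2 * x) (fun h => by simpa using (of_mul_inj.1 h).1) ?_ ?_ ?_
    (comm x y) (c.1.symm (comm y x))
  · have := c.2 (substHom x 1 1) _ _ hrel
    simpa only [map_mul, map_pow, substHom_x, substHom_y, one_pow, one_mul, mul_one, ← pow_add,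
      ← pow_succ] using this
  · intro ξ a b
    simp only [map_mul, map_pow]
    generalize ξ x = u
    generalize ξ y = v
    by_cases hu : u = 1
    · subst hu
      by_cases hv : v = 1
      · simp [hv]
      have h₁ := nocube (a := a) (w := v) (b := b) rfl hv
      have h₂ := nocube (a := a) (w := v) (b := v * b) rfl hv
      simp only [pow_succ, pow_zero, one_mul, mul_one, mul_assoc] at h₁ h₂ ⊢
      simp [h₁, h₂]
    by_cases hv : v = 1
    · subst hv
      have h₁ := nocube (a := a) (w := u) (b := b) rfl hu
      have h₂ := nocube (a := a) (w := u) (b := u * b) rfl hu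
      simp only [pow_succ, pow_zero, one_mul, mul_one, mul_assoc] at h₁ h₂ ⊢
      simp [h₁, h₂]
    have hlu := length_pos hu
    have hlv := length_pos hv
    by_cases hlen : a = 1 ∧ b = 1 ∧ u.length = 1 ∧ v.length = 1
    · obtain ⟨rfl, rfl, hu', hv'⟩ := hlen
      obtain ⟨m, rfl⟩ := FreeMonoid.length_eq_one.1 hu'
      obtain ⟨n, rfl⟩ := FreeMonoid.length_eq_one.1 hv'
      rw [hp, hq]
      change ([m, m, n, n, m, m, n] = [0, 0, 1, 1, 0, 0, 1] ∨
        [m, m, n, n, m, m, n] = [1, 1, 0, 0, 1, 1, 0]) ↔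
        ([n, n, m, m, n, n, m] = [0, 0, 1, 1, 0, 0, 1] ∨
        [n, n, m, m, n, n, m] = [1, 1, 0, 0, 1, 1, 0])
      simp only [List.cons.injEq]
      tauto
    · have hlen' : ¬ (a.length + 4 * u.length + 3 * v.length + b.length = 7 ∨
          a.length + 3 * u.length + 4 * v.length + b.length = 7) := by
        intro h
        refine hlen ⟨FreeMonoid.length_eq_zero.1 ?_, FreeMonoid.length_eq_zero.1 ?_, ?_, ?_⟩ <;>
          omega
      have e : ∀ {s : F}, (s = x ^ 2 * y ^ 2 * x ^ 2 * y ∨ s = y ^ 2 * x ^ 2 * y ^ 2 * x) →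
          s.length = 7 := by
        rintro _ (rfl | rfl) <;> rfl
      constructor <;> intro h <;> have := e h <;>
        simp only [FreeMonoid.length_mul, length_pow] at this <;> omega
  all_goals
    intro ξ a b
    simp only [map_mul, map_pow]
    by_cases h1 : ξ x = 1 ∧ ξ y = 1
    · simp [h1]
    · rw [not_and_or] at h1
      simp [nocube₂ _ _ a b h1, nocube₂ _ _ a b h1.symm]

/-- The six-state automaton reading words from their right end, in which `z` acts by the first
table and every other letter by the second. -/
def automaton : F →* Function.End (Fin 6) :=
  FreeMonoid.lift fun n => if n = 2 then ![1, 5, 3, 4, 4, 5] else ![5, 2, 2, 5, 5, 5]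

/-- The transformations induced by words on the states of `automaton`. -/
def transformation : Fin 10 → Fin 6 → Fin 6 :=
  ![![0, 1, 2, 3, 4, 5], ![1, 5, 3, 4, 4, 5], ![5, 2, 2, 5, 5, 5], ![5, 5, 4, 4, 4, 5],
    ![5, 3, 3, 5, 5, 5], ![2, 5, 5, 5, 5, 5], ![3, 5, 5, 5, 5, 5], ![5, 4, 4, 5, 5, 5],
    ![4, 5, 5, 5, 5, 5], ![5, 5, 5, 5, 5, 5]]

theorem automaton_of_mul (n : ℕ) (w : F) (s : Fin 6) :
    automaton (FreeMonoid.of n * w) s =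
      (if n = 2 then ![1, 5, 3, 4, 4, 5] else ![5, 2, 2, 5, 5, 5] : Fin 6 → Fin 6)
        (automaton w s) := by
  rw [map_mul]
  rfl

theorem automaton_mul (u v : F) (s : Fin 6) :
    automaton (u * v) s = automaton u (automaton v s) := by
  rw [map_mul]
  rfl

theorem exists_transformation_eq_step (n : ℕ) (i : Fin 10) : ∃ j, ∀ s, transformation j s =
    (if n = 2 then ![1, 5, 3, 4, 4, 5] else ![5, 2, 2, 5, 5, 5] : Fin 6 → Fin 6)
      (transformation i s) := by
  split_ifs <;> revert i <;> decide

theorem transformation_transformation : ∀ i s, transformation i (transformation i s) =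
    transformation i (transformation i (transformation i s)) := by
  decide

set_option maxRecDepth 4000 in
theorem transformation_conj : ∀ i j s,
    let s' := transformation i (transformation j (transformation i s))
    s' = transformation i s' ∨
      (s' = 3 ∨ s' = 4) ∧ (transformation i s' = 3 ∨ transformation i s' = 4) := by
  decide

theorem transformation_union : ∀ i s, (s = 3 ∨ s = 4) → ∀ s', (s' = 3 ∨ s' = 4) →
    ((transformation i s = 3 ∨ transformation i s = 4) ↔
      (transformation i s' = 3 ∨ transformation i s' = 4)) := by
  decide

theorem exists_automaton_eq (w : F) : ∃ i, ∀ s, automaton w s = transformation i s := by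
  induction w using FreeMonoid.inductionOn' with
  | one => exact ⟨0, by rw [map_one]; decide⟩
  | of_mul n w ih =>
    obtain ⟨i, hi⟩ := ih
    obtain ⟨j, hj⟩ := exists_transformation_eq_step n i
    exact ⟨j, fun s => by rw [automaton_of_mul, hi, hj]⟩

theorem automaton_eq_of_notMem {w : F} (h : w ≠ 1) (hw : 2 ∉ w.toList) :
    automaton w = ![5, 2, 2, 5, 5, 5] := by
  induction w using FreeMonoid.inductionOn' with
  | one => exact absurd rfl h
  | of_mul n w ih =>
    have hn : n ≠ 2 := fun e => hw (by simp [e])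
    have hw' : 2 ∉ w.toList := fun e => hw (by simp [e])
    funext s
    rw [automaton_of_mul, if_neg hn]
    by_cases h1 : w = 1
    · subst h1
      rfl
    · rw [ih h1 hw']
      revert s
      decide

theorem exists_substHom_eq_pow (w : F) : ∃ k, substHom 1 1 x w = x ^ k ∧
    (automaton w 0 = 0 → k = 0) ∧ (automaton w 0 = 1 ∨ automaton w 0 = 2 → k = 1) ∧
    (automaton w 0 = 3 → k = 2) ∧ (automaton w 0 = 4 → 3 ≤ k) := by
  induction w using FreeMonoid.inductionOn' with
  | one => exact ⟨0, rfl, by decide⟩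
  | of_mul n w ih =>
    obtain ⟨k, hk, ih⟩ := ih
    rw [map_mul, hk, automaton_of_mul]
    generalize automaton w 0 = s at ih
    by_cases hn : n = 2
    · subst hn
      refine ⟨k + 1, (pow_succ' x k).symm, ?_⟩
      fin_cases s <;> simp at ih ⊢ <;> omega
    · have e : substHom 1 1 x (FreeMonoid.of n) = 1 := by
        simp [substHom, hn]
      refine ⟨k, by rw [e, one_mul], ?_⟩
      fin_cases s <;> simp [hn] at ih ⊢ <;> omega

/-- If `c` is modular and relates `u * z` and `z * u` for a word `u ≠ 1` not containing `z`,
then it satisfies an identity `x ^ 2 ≈ x ^ j` with `3 ≤ j`. -/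
theorem sq_rel_pow_of_modular {c : FICon}
    (hmod : ∀ b d : FICon, b ≤ d → (c ⊓ d) ⊔ b = (c ⊔ b) ⊓ d)
    {u : F} (hu : u ≠ 1) (hzu : 2 ∉ u.toList) (h : c.1 (u * z) (z * u)) :
    ∃ j, 3 ≤ j ∧ c.1 (x ^ 2) (x ^ j) := by
  have hW := automaton_eq_of_notMem hu hzu
  have hZ : automaton z = ![1, 5, 3, 4, 4, 5] := rfl
  have step := c.1.mul (c.1.symm h) (c.1.refl z)
  have step₂ := c.1.mul h (c.1.refl (z * z))
  have step₃ := c.1.mul (c.1.refl z) step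
  simp only [mul_assoc] at step step₂ step₃
  have hrel := exists_rel_of_modular hmod
    (S := {w | automaton w 0 = 3}) (T := {w | automaton w 0 = 4})
    (p := z * (u * z)) (p' := u * (z * z)) (q' := u * (z * (z * z))) (q := z * (z * (u * z)))
    (by simp [automaton_mul, hW, hZ]) (by simp [automaton_mul, hW, hZ])
    (Set.disjoint_left.2 fun w h h' => by simp_all) ?_ ?_ ?_ step
    (c.1.trans step₂ (c.1.symm step₃))
  · obtain ⟨w, hw, w', hw', hrel⟩ := hrel
    obtain ⟨k, hk, -, -, h3, -⟩ := exists_substHom_eq_pow w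
    obtain ⟨j, hj, -, -, -, h4⟩ := exists_substHom_eq_pow w'
    have := c.2 (substHom 1 1 x) _ _ hrel
    rw [hk, hj, h3 hw] at this
    exact ⟨j, h4 hw', this⟩
  · intro ξ a b
    obtain ⟨i, hi⟩ := exists_automaton_eq (ξ z)
    obtain ⟨j, hj⟩ := exists_automaton_eq (ξ u)
    obtain ⟨k, hk⟩ := exists_automaton_eq a
    simp only [map_mul, Set.mem_union, Set.mem_ofPred_eq, automaton_mul, hi, hj, hk]
    rcases transformation_conj i j (automaton b 0) with e | e
    · rw [← e]
    · exact transformation_union k _ e.1 _ e.2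
  all_goals
    intro ξ a b
    obtain ⟨i, hi⟩ := exists_automaton_eq (ξ z)
    simp only [map_mul, Set.mem_ofPred_eq, automaton_mul, hi]
    rw [← transformation_transformation]

/-- An injective encoding of all words by words in `x` and `y` in which both letters are
equally frequent. -/
def encode : F →* F :=
  FreeMonoid.lift fun n => x * (x * ((y * x) ^ (n + 1) * (y * y)))

/-- The number of occurrences of `x`, or of `y`, in `encode u`. -/
def weight (u : F) : ℕ := (u.toList.map (· + 3)).sum

theorem weight_of_mul (n : ℕ) (u : F) : weight (FreeMonoid.of n * u) = n + 3 + weight u := by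
  simp [weight]

theorem three_le_weight {u : F} (hu : u ≠ 1) : 3 ≤ weight u := by
  rcases eq_one_or u with rfl | ⟨n, u, rfl⟩
  · exact absurd rfl hu
  · rw [weight_of_mul]
    omega

theorem encode_of_mul (n : ℕ) (u : F) :
    encode (FreeMonoid.of n * u) = x * (x * ((y * x) ^ (n + 1) * (y * (y * encode u)))) := by
  rw [map_mul, encode, FreeMonoid.lift_eval_of]
  simp only [mul_assoc]

theorem encode_eq {u : F} (hu : u ≠ 1) : ∃ r, encode u = x * (x * (y * (x * r))) := by
  rcases eq_one_or u with rfl | ⟨n, u, rfl⟩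
  · exact absurd rfl hu
  · exact ⟨_, by rw [encode_of_mul, pow_succ', mul_assoc, mul_assoc]⟩

theorem pow_mul_inj {m n : ℕ} {u v : F}
    (h : (y * x) ^ m * (y * (y * u)) = (y * x) ^ n * (y * (y * v))) : m = n ∧ u = v := by
  induction m generalizing n with
  | zero =>
    cases n with
    | zero => simpa using h
    | succ n =>
      rw [pow_zero, one_mul, pow_succ', mul_assoc, mul_assoc] at h
      simpa using (of_mul_inj.1 (mul_left_cancel h)).1
  | succ m ih =>
    cases n with
    | zero =>
      rw [pow_zero, one_mul, pow_succ', mul_assoc, mul_assoc] at h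
      simpa using (of_mul_inj.1 (mul_left_cancel h)).1
    | succ n =>
      rw [pow_succ', pow_succ', mul_assoc (y * x), mul_assoc (y * x)] at h
      have := ih (mul_left_cancel h)
      exact ⟨congrArg (· + 1) this.1, this.2⟩

theorem encode_injective : Function.Injective encode := by
  intro u
  induction u using FreeMonoid.inductionOn' with
  | one =>
    intro v h
    rcases eq_one_or v with rfl | ⟨n, v, rfl⟩
    · rfl
    · rw [map_one, encode_of_mul] at h
      exact absurd h.symm (of_mul_ne_one _ _)
  | of_mul m u ih =>
    intro v h
    rcases eq_one_or v with rfl | ⟨n, v, rfl⟩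
    · rw [map_one, encode_of_mul] at h
      exact absurd h (of_mul_ne_one _ _)
    · rw [encode_of_mul, encode_of_mul] at h
      obtain ⟨e, e'⟩ := pow_mul_inj (mul_left_cancel (mul_left_cancel h))
      rw [Nat.succ_injective e, ih e']

theorem map_encode_of_map_x {ξ : F →* F} (h : ξ x = 1) (u : F) :
    ξ (encode u) = ξ y ^ weight u := by
  induction u using FreeMonoid.inductionOn' with
  | one => simp [weight]
  | of_mul n u ih =>
    rw [encode_of_mul, weight_of_mul]
    simp only [map_mul, map_pow, h, ih, one_mul, mul_one, ← pow_succ', ← pow_add]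
    congr 1
    omega

theorem map_encode_of_map_y {ξ : F →* F} (h : ξ y = 1) (u : F) :
    ξ (encode u) = ξ x ^ weight u := by
  induction u using FreeMonoid.inductionOn' with
  | one => simp [weight]
  | of_mul n u ih =>
    rw [encode_of_mul, weight_of_mul]
    simp only [map_mul, map_pow, h, ih, one_mul, ← pow_succ', ← pow_add]
    congr 1
    omega

theorem map_encode_of_map_x_map_y {ξ : F →* F} (hx : ξ x = x) (hy : ξ y = y) (u : F) :
    ξ (encode u) = encode u := by
  induction u using FreeMonoid.inductionOn' with
  | one => simp
  | of_mul n u ih =>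
    rw [encode_of_mul]
    simp only [map_mul, map_pow, hx, hy, ih]

theorem length_map_encode (ξ : F →* F) (u : F) :
    (ξ (encode u)).length = weight u * ((ξ x).length + (ξ y).length) := by
  induction u using FreeMonoid.inductionOn' with
  | one => simp [weight]
  | of_mul n u ih =>
    rw [encode_of_mul, weight_of_mul]
    simp only [map_mul, map_pow, FreeMonoid.length_mul, length_pow, ih]
    ring

theorem length_encode (u : F) : (encode u).length = weight u * 2 :=
  length_map_encode (MonoidHom.id F) u

theorem count_pow (k : ℕ) (w : F) (n : ℕ) :
    (w ^ n).toList.count k = n * w.toList.count k := by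
  induction n with
  | zero => simp
  | succ n ih => rw [pow_succ, FreeMonoid.toList_mul, List.count_append, ih, Nat.succ_mul]

theorem count_encode (u : F) (k : ℕ) :
    (encode u).toList.count k = if k < 2 then weight u else 0 := by
  induction u using FreeMonoid.inductionOn' with
  | one => simp [weight]
  | of_mul n u ih =>
    rw [encode_of_mul, weight_of_mul]
    simp only [FreeMonoid.toList_mul, List.count_append, count_pow, ih, x, y,
      FreeMonoid.toList_of]
    match k with
    | 0 => simp; omega
    | 1 => simp; omega
    | k + 2 => simp

/-- A word with the prefix `x ^ 2 * y * x` in which `x` and `y` occur `i` times and the other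
letters at most once is no `i`-th power up to a prefix and a suffix. -/
theorem mul_pow_mul_ne {i : ℕ} (hi : 3 ≤ i) {r : F}
    (hr : ∀ k, (x * (x * (y * (x * r)))).toList.count k ≤ if k < 2 then i else 1)
    {a w b : F} (hw : w ≠ 1) : a * w ^ i * b ≠ x * (x * (y * (x * r))) := by
  intro h
  have hc : ∀ k, a.toList.count k + i * w.toList.count k + b.toList.count k ≤
      if k < 2 then i else 1 := by
    intro k
    refine le_trans (le_of_eq ?_) (hr k)
    rw [← h, FreeMonoid.toList_mul, FreeMonoid.toList_mul, List.count_append, List.count_append,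
      count_pow]
  have h0 := hc 0
  have h1 := hc 1
  obtain ⟨i, rfl⟩ := Nat.exists_eq_add_of_le' hi
  obtain ⟨m, w, rfl⟩ := (eq_one_or w).resolve_left hw
  have hm : m < 2 := by
    by_contra hm
    have := hc m
    simp [hm] at this
    nlinarith
  have hmul : a * (FreeMonoid.of m * (w * (FreeMonoid.of m * (w * (FreeMonoid.of m * (w *
      ((FreeMonoid.of m * w) ^ i * b))))))) = x * (x * (y * (x * r))) := by
    rw [← h, pow_succ', pow_succ', pow_succ']
    simp only [mul_assoc]
  clear h
  rcases eq_one_or a with rfl | ⟨a0, a, rfl⟩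
  · rw [one_mul, x, y, of_mul_inj] at hmul
    obtain ⟨rfl, hmul⟩ := hmul
    rcases eq_one_or w with rfl | ⟨n, w, rfl⟩
    · simp [of_mul_inj] at hmul
    · rw [mul_assoc, of_mul_inj] at hmul
      obtain ⟨rfl, hmul⟩ := hmul
      simp at h0
      nlinarith
  rw [mul_assoc, x, y, of_mul_inj] at hmul
  obtain ⟨rfl, hmul⟩ := hmul
  have hm1 : m ≠ 0 := by
    rintro rfl
    simp at h0
    nlinarith
  rcases eq_one_or a with rfl | ⟨a1, a, rfl⟩
  · rw [one_mul, of_mul_inj] at hmul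
    exact hm1 hmul.1
  rw [mul_assoc, of_mul_inj] at hmul
  obtain ⟨rfl, hmul⟩ := hmul
  rcases eq_one_or a with rfl | ⟨a2, a, rfl⟩
  · rw [one_mul, of_mul_inj] at hmul
    obtain ⟨rfl, hmul⟩ := hmul
    rcases eq_one_or w with rfl | ⟨n, w, rfl⟩
    · simp [of_mul_inj] at hmul
    · rw [mul_assoc, of_mul_inj] at hmul
      obtain ⟨rfl, hmul⟩ := hmul
      simp at h0
      nlinarith
  rw [mul_assoc, of_mul_inj] at hmul
  obtain ⟨rfl, hmul⟩ := hmul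
  obtain rfl : m = 1 := by omega
  simp at h1
  nlinarith

theorem mul_pow_mul_ne_encode_mul {u : F} (hu : u ≠ 1) {a w b : F} (hw : w ≠ 1) :
    a * w ^ weight u * b ≠ encode u * z := by
  obtain ⟨r, hr⟩ := encode_eq hu
  have e : encode u * z = x * (x * (y * (x * (r * z)))) := by simp only [hr, mul_assoc]
  rw [e]
  refine mul_pow_mul_ne (three_le_weight hu) (fun k => ?_) hw
  rw [← e, FreeMonoid.toList_mul, List.count_append, count_encode, z, FreeMonoid.toList_of,
    List.count_singleton]
  have := three_le_weight hu
  split_ifs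
  all_goals simp_all
  omega

theorem mul_pow_mul_ne_mul_encode {u : F} (hu : u ≠ 1) {a w b : F} (hw : w ≠ 1) :
    a * w ^ weight u * b ≠ z * encode u := by
  obtain ⟨r, hr⟩ := encode_eq hu
  have hi := three_le_weight hu
  intro h
  rcases eq_one_or a with rfl | ⟨n, a, rfl⟩
  · obtain ⟨m, w, rfl⟩ := (eq_one_or w).resolve_left hw
    have hc := congrArg (fun v : F => v.toList.count 2) h
    obtain ⟨i, hi'⟩ := Nat.exists_eq_add_of_le' hi
    simp only [FreeMonoid.toList_mul, List.count_append, count_pow, count_encode] at hc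
    rw [hi', pow_succ', one_mul, mul_assoc, mul_assoc, z, of_mul_inj] at h
    obtain ⟨rfl, -⟩ := h
    simp [z] at hc
    nlinarith
  · rw [mul_assoc, mul_assoc, z, of_mul_inj, ← mul_assoc, hr] at h
    refine mul_pow_mul_ne hi (fun k => ?_) hw h.2
    rw [← hr, count_encode]
    split_ifs <;> simp

theorem map_encode_eq_encode {u v : F} (hu : u ≠ 1) (hv : v ≠ 1) (huv : weight v = weight u)
    {ξ : F →* F} (hx : ξ x ≠ 1) (hy : ξ y ≠ 1) (h : ξ (encode v) = encode u) : v = u := by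
  have hlen := congrArg FreeMonoid.length h
  rw [length_map_encode, length_encode, huv] at hlen
  have hlen' := Nat.eq_of_mul_eq_mul_left (by have := three_le_weight hu; omega) hlen
  have hX := length_pos hx
  have hY := length_pos hy
  obtain ⟨m, hm⟩ := FreeMonoid.length_eq_one.1 (show (ξ x).length = 1 by omega)
  obtain ⟨n, hn⟩ := FreeMonoid.length_eq_one.1 (show (ξ y).length = 1 by omega)
  obtain ⟨r, hr⟩ := encode_eq hu
  obtain ⟨s, hs⟩ := encode_eq hv
  have h' := h
  rw [hr, hs] at h'
  simp only [map_mul, hm, hn] at h'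
  rw [x, y, of_mul_inj, of_mul_inj, of_mul_inj] at h'
  obtain ⟨rfl, -, rfl, -⟩ := h'
  rw [map_encode_of_map_x_map_y hm hn] at h
  exact encode_injective h

/-- The only nontrivial way in which one side of a substitution instance of
`encode v * z ≈ z * encode v` is one of `encode u * z` and `z * encode u`. -/
theorem eq_of_map_encode {u v : F} (hu : u ≠ 1) (hv : v ≠ 1) (huv : weight v = weight u)
    {ξ : F →* F} (hxy : ¬ (ξ x = 1 ∧ ξ y = 1)) (hz : ξ z ≠ 1) {a b : F} :
    (a * ξ (encode v * z) * b = encode u * z ∨ a * ξ (encode v * z) * b = z * encode u ∨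
      a * ξ (z * encode v) * b = encode u * z ∨ a * ξ (z * encode v) * b = z * encode u) →
    a = 1 ∧ b = 1 ∧ ξ z = z ∧ ξ x ≠ 1 ∧ ξ y ≠ 1 ∧ ξ (encode v) = encode u := by
  have power : ∀ w : F, w ≠ 1 → ξ (encode v) = w ^ weight u → ∀ a b : F,
      a * ξ (encode v) * b ≠ encode u * z ∧ a * ξ (encode v) * b ≠ z * encode u := by
    intro w hw e a b
    rw [e]
    exact ⟨mul_pow_mul_ne_encode_mul hu hw, mul_pow_mul_ne_mul_encode hu hw⟩
  intro h
  have e₁ : a * ξ (encode v * z) * b = a * ξ (encode v) * (ξ z * b) := by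
    simp only [map_mul, mul_assoc]
  have e₂ : a * ξ (z * encode v) * b = a * ξ z * ξ (encode v) * b := by
    simp only [map_mul, mul_assoc]
  rw [e₁, e₂] at h
  have hxy' : ξ x ≠ 1 ∧ ξ y ≠ 1 := by
    by_contra hcon
    have : ∃ w : F, w ≠ 1 ∧ ξ (encode v) = w ^ weight u := by
      by_cases hx : ξ x = 1
      · exact ⟨ξ y, fun hy => hxy ⟨hx, hy⟩, huv ▸ map_encode_of_map_x hx v⟩
      · have hy : ξ y = 1 := by
          by_contra hy
          exact hcon ⟨hx, hy⟩
        exact ⟨ξ x, hx, huv ▸ map_encode_of_map_y hy v⟩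
    obtain ⟨w, hw, e⟩ := this
    have := power w hw e
    rcases h with h | h | h | h
    exacts [(this _ _).1 h, (this _ _).2 h, (this _ _).1 h, (this _ _).2 h]
  obtain ⟨hx, hy⟩ := hxy'
  have hX := length_pos hx
  have hY := length_pos hy
  have hZ := length_pos hz
  have hlen : a.length + weight u * ((ξ x).length + (ξ y).length) + (ξ z).length + b.length =
      weight u * 2 + 1 := by
    have hlz : z.length = 1 := rfl
    rcases h with h | h | h | h <;> replace h := congrArg FreeMonoid.length h <;>
      simp only [FreeMonoid.length_mul, length_map_encode, length_encode, huv, hlz] at h <;> omega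
  have hw := three_le_weight hu
  have hs : (ξ x).length + (ξ y).length = 2 := by nlinarith
  rw [hs] at hlen
  obtain rfl := FreeMonoid.length_eq_zero.1 (show a.length = 0 by omega)
  obtain rfl := FreeMonoid.length_eq_zero.1 (show b.length = 0 by omega)
  obtain ⟨k, hk⟩ := FreeMonoid.length_eq_one.1 (show (ξ z).length = 1 by omega)
  obtain ⟨m, hm⟩ := FreeMonoid.length_eq_one.1 (show (ξ x).length = 1 by omega)
  obtain ⟨n, hn⟩ := FreeMonoid.length_eq_one.1 (show (ξ y).length = 1 by omega)
  refine ⟨rfl, rfl, ?_⟩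
  obtain ⟨r, hr⟩ := encode_eq hu
  obtain ⟨s, hs⟩ := encode_eq hv
  have hlast : ∀ {p q : F} {i j : ℕ}, p * FreeMonoid.of i = q * FreeMonoid.of j → p = q ∧ i = j :=
    fun e => by simpa using List.append_inj' e rfl
  rw [hk]
  simp only [one_mul, mul_one, hk] at h
  rcases h with h | h | h | h
  · obtain ⟨e, rfl⟩ := hlast h
    exact ⟨rfl, hx, hy, e⟩
  · rw [hr, hs] at h
    simp only [map_mul, hm, mul_assoc] at h
    rw [z, x, of_mul_inj, of_mul_inj] at h
    omega
  · rw [hr, hs] at h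
    simp only [map_mul, hm, hn, mul_assoc] at h
    rw [x, y, of_mul_inj, of_mul_inj, of_mul_inj, of_mul_inj] at h
    omega
  · rw [z, of_mul_inj] at h
    obtain ⟨rfl, h⟩ := h
    exact ⟨rfl, hx, hy, h⟩

/-- If `c` is modular, satisfies a nontrivial identity, and separates the powers of `x`, then it
relates `encode u * z` and `z * encode u` for some `u ≠ 1`. -/
theorem exists_encode_mul_comm_of_modular {c : FICon} (hmod : ∀ b d : FICon, b ≤ d →
    (c ⊓ d) ⊔ b = (c ⊔ b) ⊓ d) (hpow : ∀ k l, k < l → ¬ c.1 (x ^ k) (x ^ l))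
    {u v : F} (huv : u ≠ v) (h : c.1 u v) :
    ∃ u, u ≠ 1 ∧ c.1 (encode u * z) (z * encode u) := by
  have henc : c.1 (encode u) (encode v) := c.2 encode _ _ h
  have hweight : weight v = weight u := by
    have := c.2 (substHom x 1 1) _ _ henc
    rw [map_encode_of_map_y rfl, map_encode_of_map_y rfl, substHom_x] at this
    rcases lt_trichotomy (weight v) (weight u) with hlt | heq | hlt
    · exact absurd (c.1.symm this) (hpow _ _ hlt)
    · exact heq
    · exact absurd this (hpow _ _ hlt)
  have hu : u ≠ 1 := by
    rintro rfl
    have := three_le_weight huv.symm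
    rw [hweight] at this
    simp [weight] at this
  have hv : v ≠ 1 := by
    rintro rfl
    have := three_le_weight hu
    rw [← hweight] at this
    simp [weight] at this
  have triv : ∀ (w : F) (ξ : F →* F), (ξ x = 1 ∧ ξ y = 1) ∨ ξ z = 1 →
      ξ (encode w * z) = ξ (z * encode w) := by
    rintro w ξ (⟨hx, hy⟩ | hz)
    · simp [map_encode_of_map_x hx, hy]
    · simp [hz]
  have rigid : ∀ {ξ : F →* F} {a b : F}, ¬ ((ξ x = 1 ∧ ξ y = 1) ∨ ξ z = 1) →
      ¬ (a * ξ (encode v * z) * b = encode u * z ∨ a * ξ (encode v * z) * b = z * encode u ∨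
      a * ξ (z * encode v) * b = encode u * z ∨ a * ξ (z * encode v) * b = z * encode u) := by
    intro ξ a b hξ hcon
    rw [not_or] at hξ
    obtain ⟨-, -, -, hx, hy, e⟩ := eq_of_map_encode hu hv hweight hξ.1 hξ.2 hcon
    exact huv (map_encode_eq_encode hu hv hweight hx hy e).symm
  refine ⟨u, hu, rel_of_modular hmod (p' := encode v * z) (q' := z * encode v) ?_ ?_ ?_ ?_
    (c.1.mul henc (c.1.refl z)) (c.1.mul (c.1.refl z) (c.1.symm henc))⟩
  · obtain ⟨r, hr⟩ := encode_eq hu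
    rw [hr, x, z, mul_assoc, Ne, of_mul_inj]
    simp
  · intro ξ a b
    by_cases hξ : (ξ x = 1 ∧ ξ y = 1) ∨ ξ z = 1
    · rw [triv u ξ hξ]
    rw [not_or] at hξ
    have key := eq_of_map_encode hu hu rfl hξ.1 hξ.2 (a := a) (b := b)
    constructor <;> intro hcon
    · obtain ⟨rfl, rfl, hz, -, -, e⟩ := key (by tauto)
      right
      simp [hz, e]
    · obtain ⟨rfl, rfl, hz, -, -, e⟩ := key (by tauto)
      left
      simp [hz, e]
  all_goals
    intro ξ a b
    by_cases hξ : (ξ x = 1 ∧ ξ y = 1) ∨ ξ z = 1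
    · rw [triv v ξ hξ]
    · have := rigid (a := a) (b := b) hξ
      tauto

/-- Every proper monoid variety that is a modular element of the lattice of
monoid varieties satisfies `x² ≈ x³` and `x²y ≈ yx²`: if a fully invariant
congruence `c ≠ ⊥` on `F` is a modular element of the lattice of fully
invariant congruences, then `c` relates `x²` with `x³` and `x²y` with `yx²`. -/
theorem identities_of_modular (c : FICon) (hc : c ≠ ⊥)
    (hmod : ∀ b d : FICon, b ≤ d → (c ⊓ d) ⊔ b = (c ⊔ b) ⊓ d) :
    c.1 (x ^ 2) (x ^ 3) ∧ c.1 (x ^ 2 * y) (y * x ^ 2) := by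
  obtain ⟨u, v, huv, h⟩ : ∃ u v, u ≠ v ∧ c.1 u v := by
    by_contra hcon
    push Not at hcon
    refine hc (le_bot_iff.1 fun u v h => ?_)
    obtain rfl : u = v := by
      by_contra huv
      exact hcon u v huv h
    exact (⊥ : FICon).1.refl u
  obtain ⟨w, hw, hzw, hcomm⟩ : ∃ w : F, w ≠ 1 ∧ 2 ∉ w.toList ∧ c.1 (w * z) (z * w) := by
    by_cases hpow : ∃ k l, k < l ∧ c.1 (x ^ k) (x ^ l)
    · obtain ⟨k, l, hkl, hpow⟩ := hpow
      have := c.2 (substHom x z 1) _ _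
        (pow_mul_comm_of_modular hmod hkl (Nat.le_add_right k 2) (Nat.le_add_left 2 k) hpow)
      simp only [map_mul, map_pow, substHom_x, substHom_y] at this
      refine ⟨x ^ (k + 2), ?_, ?_, this⟩
      · rw [pow_succ']
        exact of_mul_ne_one _ _
      · rw [← List.count_eq_zero, count_pow]
        simp [x]
    · push Not at hpow
      obtain ⟨u, hu, hcomm⟩ := exists_encode_mul_comm_of_modular hmod hpow huv h
      refine ⟨encode u, fun e => hu (encode_injective (e.trans (map_one encode).symm)), ?_, hcomm⟩
      rw [← List.count_eq_zero, count_encode]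
      simp
  obtain ⟨j, hj, hsq⟩ := sq_rel_pow_of_modular hmod hw hzw hcomm
  have hcentral := pow_mul_comm_of_modular hmod (Nat.lt_of_succ_le hj) le_rfl le_rfl hsq
  refine ⟨?_, hcentral⟩
  have hstep : ∀ n, c.1 (x ^ (n + 4)) (x ^ (n + 3)) := fun n => by
    simpa only [← pow_add] using c.1.mul (c.1.refl (x ^ n)) (pow_four_of_modular hmod hcentral)
  have hstable : ∀ n, c.1 (x ^ (n + 3)) (x ^ 3) := fun n => by
    induction n with
    | zero => exact c.1.refl _
    | succ n ih => exact c.1.trans (hstep n) ih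
  obtain ⟨n, rfl⟩ := Nat.exists_eq_add_of_le' hj
  exact c.1.trans hsq (hstable n)
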